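/- For ξ(t) = (cos²t + 2t·sin t·cos t + t² − π²/4)/cos²t, the function t ↦ ξ'(t)/t is strictly increasing on (0, π/2), and satisfies 2(3 − π²/4) ≤ ξ'(t)/t ≤ 4/3 for t in (0, π/2). -/

import Mathlib

open Real Set

noncomputable def xi (t : ℝ) : ℝ :=
  (Real.cos t ^ 2 + 2 * t * Real.sin t * Real.cos t + t ^ 2 - Real.pi ^ 2 / 4) / Real.cos t ^ 2

open Filter Topology

/-- The numerator of the derivative of `xi`, which is `2 * xiNum t / cos t ^ 3`. -/
noncomputable def xiNum (t : ℝ) : ℝ :=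
  2 * t * cos t + sin t * cos t ^ 2 - (π ^ 2 / 4 - t ^ 2) * sin t

/-- The derivative of `deriv xi t / t`, multiplied by the positive factor `t ^ 2 * cos t ^ 4 / 2`. -/
noncomputable def xiWronskian (t : ℝ) : ℝ :=
  t * cos t * (cos t * (3 * cos t ^ 2 - π ^ 2 / 4 + t ^ 2)) + 3 * t * sin t * xiNum t
    - cos t * xiNum t

/-- One quarter of the derivative of `xiWronskian`. -/
noncomputable def xiResidual (t : ℝ) : ℝ :=
  xiNum t * (t * cos t + sin t) - t * sin t * cos t ^ 3

theorem hasDerivAt_xiNum (t : ℝ) :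
    HasDerivAt xiNum (cos t * (3 * cos t ^ 2 - π ^ 2 / 4 + t ^ 2)) t := by
  have hs := hasDerivAt_sin t
  have hc := hasDerivAt_cos t
  have hi := hasDerivAt_id t
  have h := (((hi.const_mul 2).mul hc).add (hs.mul (hc.pow 2))).sub
    (((hi.pow 2).const_sub (π ^ 2 / 4)).mul hs)
  refine h.congr_deriv ?_
  simp
  linear_combination (-2 * cos t) * sin_sq_add_cos_sq t

theorem hasDerivAt_xiWronskian (t : ℝ) :
    HasDerivAt xiWronskian (4 * xiResidual t) t := by
  have hs := hasDerivAt_sin t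
  have hc := hasDerivAt_cos t
  have hi := hasDerivAt_id t
  have hn := hasDerivAt_xiNum t
  have h := (((hi.mul hc).mul
    (hc.mul ((((hc.pow 2).const_mul 3).sub_const (π ^ 2 / 4)).add (hi.pow 2)))).add
    (((hi.const_mul 3).mul hs).mul hn)).sub (hc.mul hn)
  refine h.congr_deriv ?_
  simp [xiResidual, xiNum]
  ring

theorem hasDerivAt_xiResidual (t : ℝ) :
    HasDerivAt xiResidual
      (cos t * (3 * cos t ^ 2 - π ^ 2 / 4 + t ^ 2) * (t * cos t + sin t)
        + xiNum t * (2 * cos t - t * sin t)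
        - sin t * cos t ^ 3 - t * cos t ^ 4 + 3 * t * sin t ^ 2 * cos t ^ 2) t := by
  have hs := hasDerivAt_sin t
  have hc := hasDerivAt_cos t
  have hi := hasDerivAt_id t
  have hn := hasDerivAt_xiNum t
  have h := (hn.mul ((hi.mul hc).add hs)).sub ((hi.mul hs).mul (hc.pow 3))
  refine h.congr_deriv ?_
  simp
  ring

theorem cos_pos_of_mem_Ioo_zero {t : ℝ} (ht : t ∈ Ioo 0 (π / 2)) : 0 < cos t :=
  cos_pos_of_mem_Ioo ⟨by linarith [ht.1, pi_pos], ht.2⟩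

theorem deriv_xiResidual_neg {t : ℝ} (ht : t ∈ Ioo 0 (π / 2)) (hE : xiResidual t = 0)
    (hD : xiWronskian t ≤ 0) : deriv xiResidual t < 0 := by
  have hc : 0 < cos t := cos_pos_of_mem_Ioo_zero ht
  have hs : 0 < sin t := sin_pos_of_pos_of_lt_pi ht.1 (by linarith [ht.2, pi_pos])
  have ht0 := ht.1
  have hlt : 0 < t - sin t * cos t := by
    nlinarith [sin_lt ht0, cos_le_one t]
  have hF : 0 < t * cos t + sin t := by positivity
  rw [(hasDerivAt_xiResidual t).deriv]
  refine neg_of_mul_neg_right (a := t * cos t * (t * cos t + sin t)) ?_ (by positivity)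
  have key : t * cos t * (t * cos t + sin t) *
      (cos t * (3 * cos t ^ 2 - π ^ 2 / 4 + t ^ 2) * (t * cos t + sin t)
        + xiNum t * (2 * cos t - t * sin t)
        - sin t * cos t ^ 3 - t * cos t ^ 4 + 3 * t * sin t ^ 2 * cos t ^ 2) =
      (t * cos t + sin t) ^ 2 * xiWronskian t
        - t ^ 2 * cos t ^ 4 * (t - sin t * cos t) := by
    unfold xiResidual at hE
    unfold xiWronskian
    linear_combination ((t * cos t + sin t) * (cos t - 3 * t * sin t)
      + t * cos t * (2 * cos t - t * sin t)) * hE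
      - t ^ 3 * cos t ^ 4 * sin_sq_add_cos_sq t
  rw [key]
  have h1 : (t * cos t + sin t) ^ 2 * xiWronskian t ≤ 0 :=
    mul_nonpos_of_nonneg_of_nonpos (by positivity) hD
  have h2 : 0 < t ^ 2 * cos t ^ 4 * (t - sin t * cos t) := by positivity
  linarith

theorem not_isLocalMin_of_deriv_deriv_neg {f : ℝ → ℝ} {x : ℝ} (hf : deriv (deriv f) x < 0)
    (hd : deriv f x = 0) (hc : ContinuousAt f x) : ¬ IsLocalMin f x := by
  intro hmin
  have hmax := isLocalMax_of_deriv_deriv_neg hf hd hc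
  have heq : f =ᶠ[𝓝 x] fun _ => f x := by
    filter_upwards [hmin, hmax] with y h1 h2 using le_antisymm h2 h1
  have h := heq.deriv.deriv_eq
  simp at h
  linarith

theorem xiWronskian_pos {t : ℝ} (ht : t ∈ Ioo 0 (π / 2)) : 0 < xiWronskian t := by
  by_contra! hneg
  have hcont : Continuous xiWronskian :=
    continuous_iff_continuousAt.2 fun x => (hasDerivAt_xiWronskian x).continuousAt
  obtain ⟨x, hx, hmin⟩ := isCompact_Icc.exists_isMinOn
    (nonempty_Icc.2 (by positivity : (0 : ℝ) ≤ π / 2)) hcont.continuousOn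
  have h0 : xiWronskian 0 = 0 := by simp [xiWronskian, xiNum]
  have h1 : xiWronskian (π / 2) = 0 := by
    simp [xiWronskian, xiNum]
    ring
  obtain ⟨y, hy, hyneg, hymin⟩ : ∃ y ∈ Ioo 0 (π / 2), xiWronskian y ≤ 0 ∧
      IsMinOn xiWronskian (Icc 0 (π / 2)) y := by
    have hxt : xiWronskian x ≤ xiWronskian t := hmin (Ioo_subset_Icc_self ht)
    by_cases hx0 : xiWronskian x = 0
    · exact ⟨t, ht, hneg, fun z hz => (hneg.trans hx0.ge).trans (hmin hz)⟩
    · refine ⟨x, ⟨hx.1.lt_of_ne ?_, hx.2.lt_of_ne ?_⟩, hxt.trans hneg, hmin⟩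
      · rintro rfl; exact hx0 h0
      · rintro rfl; exact hx0 h1
  have hloc := hymin.isLocalMin (Icc_mem_nhds hy.1 hy.2)
  have hd := hloc.deriv_eq_zero
  have hE : xiResidual y = 0 := by
    rw [(hasDerivAt_xiWronskian y).deriv] at hd
    linarith
  refine not_isLocalMin_of_deriv_deriv_neg ?_ hd hcont.continuousAt hloc
  have : deriv xiWronskian = fun z => 4 * xiResidual z :=
    funext fun z => (hasDerivAt_xiWronskian z).deriv
  rw [this, deriv_const_mul _ (hasDerivAt_xiResidual y).differentiableAt]
  linarith [deriv_xiResidual_neg hy hE hyneg]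

theorem deriv_xi {t : ℝ} (hc : cos t ≠ 0) : deriv xi t = 2 * xiNum t / cos t ^ 3 := by
  have hs := hasDerivAt_sin t
  have hcos := hasDerivAt_cos t
  have hi := hasDerivAt_id t
  have h := ((((hcos.pow 2).add (((hi.const_mul 2).mul hs).mul hcos)).add
    (hi.pow 2)).sub_const (π ^ 2 / 4)).div (hcos.pow 2) (pow_ne_zero 2 hc)
  have h' : HasDerivAt xi (2 * xiNum t / cos t ^ 3) t := by
    refine h.congr_deriv ?_
    simp [xiNum]
    field_simp
    linear_combination (4 * t * cos t) * sin_sq_add_cos_sq t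
  exact h'.deriv

theorem strictMonoOn_xiNum_div :
    StrictMonoOn (fun t => 2 * xiNum t / cos t ^ 3 / t) (Ioo 0 (π / 2)) := by
  have hder : ∀ t ∈ Ioo 0 (π / 2), HasDerivAt (fun t => 2 * xiNum t / cos t ^ 3 / t)
      (2 * xiWronskian t / (t ^ 2 * cos t ^ 4)) t := by
    intro t ht
    have hc := (cos_pos_of_mem_Ioo_zero ht).ne'
    have ht0 := ht.1.ne'
    have h := (((hasDerivAt_xiNum t).const_mul 2).div ((hasDerivAt_cos t).pow 3)
      (pow_ne_zero 3 hc)).div (hasDerivAt_id t) ht0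
    refine h.congr_deriv ?_
    simp [xiWronskian]
    field_simp
  refine strictMonoOn_of_deriv_pos (convex_Ioo _ _)
    (fun t ht => (hder t ht).continuousAt.continuousWithinAt) fun t ht => ?_
  rw [interior_Ioo] at ht
  rw [(hder t ht).deriv]
  have := cos_pos_of_mem_Ioo_zero ht
  have := xiWronskian_pos ht
  have := ht.1
  positivity

theorem tendsto_xiNum_div_zero :
    Tendsto (fun t => 2 * xiNum t / cos t ^ 3 / t) (𝓝[>] 0) (𝓝 (2 * (3 - π ^ 2 / 4))) := by
  have h := (hasDerivAt_iff_tendsto_slope.1 (hasDerivAt_xiNum 0)).mono_left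
    (nhdsWithin_mono 0 fun x (hx : 0 < x) => hx.ne')
  have hc : Tendsto (fun t => 2 / cos t ^ 3) (𝓝[>] 0) (𝓝 2) := by
    have : ContinuousAt (fun t => 2 / cos t ^ 3) 0 :=
      continuousAt_const.div (by fun_prop) (by simp)
    simpa using this.tendsto.mono_left nhdsWithin_le_nhds
  have h2 := hc.mul h
  simp only [cos_zero] at h2
  convert h2 using 2 with t
  · simp [slope_def_field, xiNum]
    ring
  · ring

theorem tendsto_xiNum_div_cos_pow :
    Tendsto (fun t => xiNum t / cos t ^ 3) (𝓝[<] (π / 2)) (𝓝 (π / 3)) := by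
  have hpi : (0 : ℝ) < π / 2 := by positivity
  have hsin : ∀ t ∈ Ioo 0 (π / 2), 0 < sin t := fun t ht =>
    sin_pos_of_pos_of_lt_pi ht.1 (by linarith [ht.2, pi_pos])
  have hquarter : π / 4 < π / 2 := by linarith
  have hsecond : Tendsto (fun t => (3 * cos t ^ 2 - π ^ 2 / 4 + t ^ 2) / (-3 * (cos t * sin t)))
      (𝓝[<] (π / 2)) (𝓝 (π / 3)) := by
    refine HasDerivAt.lhopital_zero_left_on_Ioo (a := π / 4)
      (f' := fun t => -6 * cos t * sin t + 2 * t)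
      (g' := fun t => -3 * (cos t ^ 2 - sin t ^ 2)) hquarter ?_ ?_ ?_ ?_ ?_ ?_
    · intro t _
      have h := ((((hasDerivAt_cos t).pow 2).const_mul 3).sub_const (π ^ 2 / 4)).add
        ((hasDerivAt_id t).pow 2)
      refine h.congr_deriv ?_
      simp
      ring
    · intro t _
      have h := ((hasDerivAt_cos t).mul (hasDerivAt_sin t)).const_mul (-3)
      refine h.congr_deriv ?_
      ring
    · intro t ht
      have h : cos (2 * t) < 0 :=
        cos_neg_of_pi_div_two_lt_of_lt (by linarith [ht.1]) (by linarith [ht.2, pi_pos])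
      rw [cos_two_mul'] at h
      nlinarith
    · have h : Continuous fun t : ℝ => 3 * cos t ^ 2 - π ^ 2 / 4 + t ^ 2 := by fun_prop
      have h2 := (h.tendsto (π / 2)).mono_left (nhdsWithin_le_nhds (s := Iio (π / 2)))
      convert h2 using 2
      simp
      ring
    · have h : Continuous fun t : ℝ => -3 * (cos t * sin t) := by fun_prop
      simpa using (h.tendsto (π / 2)).mono_left (nhdsWithin_le_nhds (s := Iio (π / 2)))
    · have h : ContinuousAt (fun t : ℝ => (-6 * cos t * sin t + 2 * t) /
          (-3 * (cos t ^ 2 - sin t ^ 2))) (π / 2) :=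
        ContinuousAt.div (by fun_prop) (by fun_prop) (by simp)
      have h2 := h.tendsto.mono_left (nhdsWithin_le_nhds (s := Iio (π / 2)))
      convert h2 using 2
      simp
      ring
  refine HasDerivAt.lhopital_zero_left_on_Ioo hpi (fun t _ => hasDerivAt_xiNum t)
    (fun t _ => (hasDerivAt_cos t).pow 3) ?_ ?_ ?_ ?_
  · intro t ht
    have := cos_pos_of_mem_Ioo_zero ht
    have := hsin t ht
    simp
    constructor <;> positivity
  · have h := ((hasDerivAt_xiNum (π / 2)).continuousAt.tendsto).mono_left
      (nhdsWithin_le_nhds (s := Iio (π / 2)))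
    convert h using 2
    simp [xiNum]
    ring
  · have h : Continuous fun t : ℝ => cos t ^ 3 := by fun_prop
    simpa using (h.tendsto (π / 2)).mono_left (nhdsWithin_le_nhds (s := Iio (π / 2)))
  · refine hsecond.congr' ?_
    filter_upwards [Ioo_mem_nhdsLT hpi] with t ht
    have := (cos_pos_of_mem_Ioo_zero ht).ne'
    have := (hsin t ht).ne'
    simp
    field_simp

theorem tendsto_xiNum_div_pi_div_two :
    Tendsto (fun t => 2 * xiNum t / cos t ^ 3 / t) (𝓝[<] (π / 2)) (𝓝 (4 / 3)) := by
  have hid : Tendsto (fun t : ℝ => t) (𝓝[<] (π / 2)) (𝓝 (π / 2)) :=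
    tendsto_id.mono_left nhdsWithin_le_nhds
  have h := (tendsto_xiNum_div_cos_pow.const_mul 2).div hid (by positivity)
  convert h using 2 with t
  · simp only [Pi.div_apply]
    ring
  · field_simp
    norm_num

theorem xi_deriv_div_t :
    StrictMonoOn (fun t => deriv xi t / t) (Ioo (0:ℝ) (Real.pi / 2)) ∧
    (∀ t ∈ Ioo (0:ℝ) (Real.pi / 2),
      2 * (3 - Real.pi ^ 2 / 4) ≤ deriv xi t / t ∧ deriv xi t / t ≤ 4 / 3) := by
  have hmono := strictMonoOn_xiNum_div
  have heq : EqOn (fun t => 2 * xiNum t / cos t ^ 3 / t) (fun t => deriv xi t / t)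
      (Ioo 0 (π / 2)) := fun t ht => by
    simp only [deriv_xi (cos_pos_of_mem_Ioo_zero ht).ne']
  refine ⟨hmono.congr heq, fun t ht => ?_⟩
  have hval : 2 * xiNum t / cos t ^ 3 / t = deriv xi t / t := heq ht
  rw [← hval]
  constructor
  · refine le_of_tendsto tendsto_xiNum_div_zero ?_
    filter_upwards [Ioo_mem_nhdsGT ht.1] with s hs
    exact (hmono ⟨hs.1, hs.2.trans ht.2⟩ ht hs.2).le
  · refine ge_of_tendsto tendsto_xiNum_div_pi_div_two ?_
    filter_upwards [Ioo_mem_nhdsLT ht.2] with s hs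
    exact (hmono ht ⟨ht.1.trans hs.1, hs.2⟩ hs.1).le
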